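/- arXiv:2302.05951 — 4 statements merged into one kernel-verified Lean document; each statement's English description precedes it below -/
import Mathlib

section
/- Let G be a finite simple graph on an n-element vertex set V and let k ≥ 1 be an integer. Set G₁ := G and, for i = 1, …, k, let F_i be a spanning forest of G_i and let G_{i+1} be G_i with the edges of F_i removed. Let H := F₁ ∪ … ∪ F_k (a subgraph of G). Then H is a k-connectivity certificate of G, i.e. for every S ⊆ V one has min(k, |∂_H(S)|) = min(k, |∂_G(S)|); moreover H has at most k·(n − 1) edges. -/
open scoped Classical

/-- The edge boundary of a vertex set `S` in a simple graph `G`: the set of edges of `G`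
with exactly one endpoint in `S`. -/
noncomputable def edgeBoundary {V : Type*} [Fintype V] (G : SimpleGraph V) (S : Finset V) :
    Finset (Sym2 V) :=
  Finset.univ.filter (fun e => e ∈ G.edgeSet ∧ ∃ v w, e = s(v, w) ∧ v ∈ S ∧ w ∉ S)

/-- `F` is a spanning forest of `G`: a subgraph of `G` that is acyclic and preserves
reachability. -/
def IsSpanningForest {V : Type*} (G F : SimpleGraph V) : Prop :=
  F ≤ G ∧ F.IsAcyclic ∧ ∀ u v : V, G.Reachable u v → F.Reachable u v

theorem mem_edgeBoundary {V : Type*} [Fintype V] {G : SimpleGraph V} {S : Finset V}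
    {e : Sym2 V} :
    e ∈ edgeBoundary G S ↔ e ∈ G.edgeSet ∧ ∃ v w, e = s(v, w) ∧ v ∈ S ∧ w ∉ S := by
  simp [edgeBoundary]

theorem edgeBoundary_mono {V : Type*} [Fintype V] {G G' : SimpleGraph V} (h : G ≤ G')
    (S : Finset V) : edgeBoundary G S ⊆ edgeBoundary G' S := fun e he => by
  rw [mem_edgeBoundary] at he ⊢
  exact ⟨SimpleGraph.edgeSet_mono h he.1, he.2⟩

theorem edgeBoundary_sup {V : Type*} [Fintype V] (G G' : SimpleGraph V) (S : Finset V) :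
    edgeBoundary (G ⊔ G') S = edgeBoundary G S ∪ edgeBoundary G' S := by
  ext e
  simp only [mem_edgeBoundary, Finset.mem_union, SimpleGraph.edgeSet_sup, Set.mem_union,
    or_and_right]

theorem disjoint_edgeBoundary {V : Type*} [Fintype V] {G G' : SimpleGraph V}
    (h : Disjoint G G') (S : Finset V) : Disjoint (edgeBoundary G S) (edgeBoundary G' S) := by
  rw [Finset.disjoint_left]
  intro e he he'
  rw [mem_edgeBoundary] at he he'
  exact Set.disjoint_left.1 (SimpleGraph.disjoint_edgeSet.2 h) he.1 he'.1

theorem IsSpanningForest.edgeBoundary_nonempty {V : Type*} [Fintype V] {G F : SimpleGraph V}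
    (hF : IsSpanningForest G F) {S : Finset V} (hS : (edgeBoundary G S).Nonempty) :
    (edgeBoundary F S).Nonempty := by
  obtain ⟨e, he⟩ := hS
  obtain ⟨hadj, v, w, rfl, hv, hw⟩ := mem_edgeBoundary.1 he
  obtain ⟨p⟩ := hF.2.2 v w (SimpleGraph.Adj.reachable hadj)
  obtain ⟨d, -, hd, hd'⟩ := p.exists_boundary_dart (S : Set V) hv hw
  exact ⟨s(d.fst, d.snd), mem_edgeBoundary.2 ⟨d.adj, _, _, rfl, hd, hd'⟩⟩

theorem SimpleGraph.IsAcyclic.card_edgeFinset_le {V : Type*} [Fintype V] {F : SimpleGraph V}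
    (hF : F.IsAcyclic) : F.edgeFinset.card ≤ Fintype.card V - 1 := by
  rcases isEmpty_or_nonempty V with hV | hV
  · simp [Subsingleton.elim F ⊥]
  · obtain ⟨T, hFT, -, hT⟩ :=
      SimpleGraph.connected_top.exists_isTree_le_of_le_of_isAcyclic (le_top : F ≤ ⊤) hF
    have hcard := hT.card_edgeFinset
    have hle := Finset.card_le_card (SimpleGraph.edgeFinset_mono hFT)
    omega

theorem SimpleGraph.card_edgeFinset_sup_le {V : Type*} (G G' : SimpleGraph V)
    [Fintype G.edgeSet] [Fintype G'.edgeSet] {_ : Fintype (G ⊔ G').edgeSet} :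
    (G ⊔ G').edgeFinset.card ≤ G.edgeFinset.card + G'.edgeFinset.card := by
  have hunion : (G ⊔ G').edgeFinset = G.edgeFinset ∪ G'.edgeFinset := by
    ext e
    simp
  exact hunion ▸ Finset.card_union_le _ _

/-- After `m` rounds of peeling off spanning forests, the peeled part and the remainder
partition `G`, and every cut still met by the remainder is met `m` times by the peeled part. -/
theorem nested_spanning_forests_partition {V : Type*} [Fintype V] (G : SimpleGraph V) (k : ℕ)
    (Gs F : ℕ → SimpleGraph V) (hG1 : Gs 1 = G)
    (hF : ∀ i, 1 ≤ i → i ≤ k → IsSpanningForest (Gs i) (F i))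
    (hGs : ∀ i, 1 ≤ i → i ≤ k → Gs (i + 1) = Gs i \ F i) (m : ℕ) (hm : m ≤ k) :
    (⨆ i ∈ Finset.Icc 1 m, F i) ⊔ Gs (m + 1) = G ∧
      Disjoint (⨆ i ∈ Finset.Icc 1 m, F i) (Gs (m + 1)) ∧
      (∀ S : Finset V, (edgeBoundary (Gs (m + 1)) S).Nonempty →
        m ≤ (edgeBoundary (⨆ i ∈ Finset.Icc 1 m, F i) S).card) ∧
      (⨆ i ∈ Finset.Icc 1 m, F i).edgeFinset.card ≤ m * (Fintype.card V - 1) := by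
  induction m with
  | zero => simp [hG1]
  | succ m ih =>
    obtain ⟨hsup, hdisj, hcut, hcard⟩ := ih (by omega)
    have hFm := hF (m + 1) (by omega) hm
    have hsucc : (⨆ i ∈ Finset.Icc 1 (m + 1), F i) =
        (⨆ i ∈ Finset.Icc 1 m, F i) ⊔ F (m + 1) := by
      rw [← Finset.insert_Icc_right_eq_Icc_add_one (by omega), Finset.iSup_insert, sup_comm]
    rw [hGs (m + 1) (by omega) hm, hsucc]
    generalize (⨆ i ∈ Finset.Icc 1 m, F i) = H at *
    refine ⟨?_, ?_, fun S hS => ?_, ?_⟩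
    · rw [sup_assoc, sup_sdiff_cancel_right hFm.1, hsup]
    · exact Disjoint.sup_left (hdisj.mono_right sdiff_le) disjoint_sdiff_self_right
    · have hS' := hS.mono (edgeBoundary_mono sdiff_le S)
      rw [edgeBoundary_sup,
        Finset.card_union_of_disjoint (disjoint_edgeBoundary (hdisj.mono_right hFm.1) S)]
      exact Nat.add_le_add (hcut S hS') (hFm.edgeBoundary_nonempty hS').card_pos
    · rw [Nat.add_mul, one_mul]
      exact le_trans (SimpleGraph.card_edgeFinset_sup_le H (F (m + 1)))
        (Nat.add_le_add hcard hFm.2.1.card_edgeFinset_le)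

theorem nested_spanning_forests_give_certificate
    {V : Type*} [Fintype V] (G : SimpleGraph V) (k : ℕ) (hk : 1 ≤ k)
    (Gs F : ℕ → SimpleGraph V) (hG1 : Gs 1 = G)
    (hF : ∀ i, 1 ≤ i → i ≤ k → IsSpanningForest (Gs i) (F i))
    (hGs : ∀ i, 1 ≤ i → i ≤ k → Gs (i + 1) = Gs i \ F i)
    (H : SimpleGraph V) (hH : H = ⨆ i ∈ Finset.Icc 1 k, F i) :
    (∀ S : Finset V, min k (edgeBoundary H S).card = min k (edgeBoundary G S).card) ∧
      H.edgeFinset.card ≤ k * (Fintype.card V - 1) := by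
  obtain ⟨hsup, -, hcut, hcard⟩ :=
    nested_spanning_forests_partition G k Gs F hG1 hF hGs k le_rfl
  subst hH
  refine ⟨fun S => ?_, hcard⟩
  rcases (edgeBoundary (Gs (k + 1)) S).eq_empty_or_nonempty with hS | hS
  · rw [← hsup, edgeBoundary_sup, hS, Finset.union_empty]
  · have hle := Finset.card_le_card (edgeBoundary_mono (hsup ▸ le_sup_left) S)
    rw [min_eq_left (hcut S hS), min_eq_left ((hcut S hS).trans hle)]
end

section
/- Let G be a finite simple graph on a vertex set V with |V| ≥ 2, and let 𝒫 be a partition of V such that every non-singleton minimum cut C of G (i.e. a cut with min(|C|, |V ∖ C|) ≥ 2 and |∂_G(C)| = λ(G)) is respected by 𝒫, meaning every part P ∈ 𝒫 satisfies P ⊆ C or P ∩ C = ∅. Let u ≠ v be two vertices lying in the same part of 𝒫 with {u, v} not an edge of G, and let G′ be G with the edge {u, v} added. Then the edge {u, v} crosses no non-singleton minimum cut of G′: there is no cut C of G′ with min(|C|, |V ∖ C|) ≥ 2, |∂_{G′}(C)| = λ(G′), and exactly one of u, v in C. -/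
open scoped Classical

/-- The edge connectivity of `G`: the minimum size of the edge boundary over all cuts,
i.e. over all vertex sets `S` with `∅ ⊊ S ⊊ V`. -/
noncomputable def edgeConn {V : Type*} [Fintype V] (G : SimpleGraph V) : ℕ :=
  sInf {n | ∃ S : Finset V, S.Nonempty ∧ S ≠ Finset.univ ∧ (edgeBoundary G S).card = n}

/-- `C` is a non-singleton minimum cut of `G`: both sides have at least two vertices and
the boundary attains the edge connectivity. -/
noncomputable def IsNonsingletonMinCut {V : Type*} [Fintype V] (G : SimpleGraph V)
    (C : Finset V) : Prop :=
  2 ≤ C.card ∧ 2 ≤ (Finset.univ \ C).card ∧ (edgeBoundary G C).card = edgeConn G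

theorem edgeConn_le_card_edgeBoundary {V : Type*} [Fintype V] (G : SimpleGraph V)
    {S : Finset V} (hS : S.Nonempty) (hS' : S ≠ Finset.univ) :
    edgeConn G ≤ (edgeBoundary G S).card :=
  Nat.sInf_le ⟨S, hS, hS', rfl⟩

theorem exists_card_edgeBoundary_eq_edgeConn {V : Type*} [Fintype V] (G : SimpleGraph V)
    (hV : 2 ≤ Fintype.card V) :
    ∃ S : Finset V, S.Nonempty ∧ S ≠ Finset.univ ∧ (edgeBoundary G S).card = edgeConn G := by
  obtain ⟨a⟩ : Nonempty V := Fintype.card_pos_iff.mp (by omega)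
  refine Nat.sInf_mem
    (s := {n | ∃ S : Finset V, S.Nonempty ∧ S ≠ Finset.univ ∧ (edgeBoundary G S).card = n})
    ⟨_, {a}, Finset.singleton_nonempty a, fun h => ?_, rfl⟩
  have := congrArg Finset.card h
  rw [Finset.card_singleton, Finset.card_univ] at this
  omega

theorem edgeBoundary_sup_edge_subset {V : Type*} [Fintype V] (G : SimpleGraph V) (u v : V)
    (S : Finset V) :
    edgeBoundary (G ⊔ SimpleGraph.fromEdgeSet {s(u, v)}) S ⊆
      insert s(u, v) (edgeBoundary G S) := by
  intro e he
  simp only [edgeBoundary, Finset.mem_filter, Finset.mem_insert, Finset.mem_univ, true_and,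
    SimpleGraph.edgeSet_sup, SimpleGraph.edgeSet_fromEdgeSet, Set.mem_union, Set.mem_sdiff,
    Set.mem_singleton_iff] at he ⊢
  tauto

theorem insert_edgeBoundary_subset_sup_edge {V : Type*} [Fintype V] (G : SimpleGraph V)
    {u v : V} (huv : u ≠ v) {S : Finset V} (hS : Xor' (u ∈ S) (v ∈ S)) :
    insert s(u, v) (edgeBoundary G S) ⊆
      edgeBoundary (G ⊔ SimpleGraph.fromEdgeSet {s(u, v)}) S := by
  intro e he
  simp only [edgeBoundary, Finset.mem_filter, Finset.mem_insert, Finset.mem_univ, true_and,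
    SimpleGraph.edgeSet_sup, SimpleGraph.edgeSet_fromEdgeSet, Set.mem_union, Set.mem_sdiff,
    Set.mem_singleton_iff] at he ⊢
  rcases he with rfl | ⟨he, hcross⟩
  · refine ⟨Or.inr ⟨rfl, by simpa using huv⟩, ?_⟩
    rcases hS with ⟨hu, hv⟩ | ⟨hv, hu⟩
    · exact ⟨u, v, rfl, hu, hv⟩
    · exact ⟨v, u, Sym2.eq_swap, hv, hu⟩
  · exact ⟨Or.inl he, hcross⟩

theorem edgeConn_sup_edge_le {V : Type*} [Fintype V] (hV : 2 ≤ Fintype.card V)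
    (G : SimpleGraph V) (u v : V) :
    edgeConn (G ⊔ SimpleGraph.fromEdgeSet {s(u, v)}) ≤ edgeConn G + 1 := by
  obtain ⟨S, hS, hS', hcard⟩ := exists_card_edgeBoundary_eq_edgeConn G hV
  calc edgeConn (G ⊔ SimpleGraph.fromEdgeSet {s(u, v)})
      ≤ (edgeBoundary (G ⊔ SimpleGraph.fromEdgeSet {s(u, v)}) S).card :=
        edgeConn_le_card_edgeBoundary _ hS hS'
    _ ≤ (insert s(u, v) (edgeBoundary G S)).card :=
        Finset.card_le_card (edgeBoundary_sup_edge_subset G u v S)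
    _ ≤ edgeConn G + 1 := hcard ▸ Finset.card_insert_le _ _

theorem edge_inside_part_crosses_no_nonsingleton_mincut
    {V : Type*} [Fintype V] (hV : 2 ≤ Fintype.card V) (G : SimpleGraph V)
    (P : Finpartition (Finset.univ : Finset V))
    (hresp : ∀ C : Finset V, IsNonsingletonMinCut G C →
      ∀ p ∈ P.parts, p ⊆ C ∨ p ∩ C = ∅)
    (u v : V) (huv : u ≠ v) (hnadj : ¬ G.Adj u v)
    (hsame : ∃ p ∈ P.parts, u ∈ p ∧ v ∈ p)
    (G' : SimpleGraph V) (hG' : G' = G ⊔ SimpleGraph.fromEdgeSet {s(u, v)}) :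
    ¬ ∃ C : Finset V, IsNonsingletonMinCut G' C ∧ Xor' (u ∈ C) (v ∈ C) := by
  subst hG'
  rintro ⟨C, ⟨hC, hC', hmin⟩, hcross⟩
  have hnotMem : s(u, v) ∉ edgeBoundary G C := by
    simp [edgeBoundary, hnadj]
  have hcard := Finset.card_le_card (insert_edgeBoundary_subset_sup_edge G huv hcross)
  rw [Finset.card_insert_of_notMem hnotMem, hmin] at hcard
  have hle := edgeConn_sup_edge_le hV G u v
  have hne : C.Nonempty := Finset.card_pos.mp (by omega)
  have hne' : C ≠ Finset.univ := by
    rintro rfl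
    simp at hC'
  have hge := edgeConn_le_card_edgeBoundary G hne hne'
  obtain ⟨p, hp, hup, hvp⟩ := hsame
  rcases hresp C ⟨hC, hC', by omega⟩ p hp with h | h
  · rcases hcross with ⟨_, hv⟩ | ⟨_, hu⟩
    · exact hv (h hvp)
    · exact hu (h hup)
  · rw [← Finset.disjoint_iff_inter_eq_empty, Finset.disjoint_left] at h
    rcases hcross with ⟨hu, _⟩ | ⟨hv, _⟩
    · exact h hup hu
    · exact h hvp hv
end

section
/- Let G be a finite simple graph on a vertex set V with minimum degree δ ≥ 1, and let U ⊆ V be such that the induced subgraph G[U] is a (40/δ)-expander: for every S with ∅ ⊊ S ⊊ U, the number of edges of G[U] between S and U ∖ S is at least (40/δ)·min(vol_{G[U]}(S), vol_{G[U]}(U ∖ S)). Let U′ := trim(U) be the greatest subset T ⊆ U such that every v ∈ T has at least (2/5)·d_G(v) neighbors (in G) inside T, and let U″ := shave(U′) := { v ∈ U′ : |N_G(v) ∩ U′| > d_G(v)/2 + 1 }. Then every non-singleton minimum cut C of G (i.e. a cut with min(|C|, |V ∖ C|) ≥ 2 and |∂_G(C)| = λ(G)) satisfies U″ ⊆ C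 or U″ ∩ C = ∅. -/
open scoped Classical

/-- The minimum vertex degree of `G`. -/
noncomputable def minDeg {V : Type*} [Fintype V] (G : SimpleGraph V) : ℕ :=
  sInf {n | ∃ v : V, G.degree v = n}

/-- The degree of `v` in the induced subgraph `G[U]`. -/
noncomputable def degIn {V : Type*} [Fintype V] (G : SimpleGraph V) (U : Finset V) (v : V) :
    ℕ :=
  (G.neighborFinset v ∩ U).card

/-- The volume of `S` in the induced subgraph `G[U]`. -/
noncomputable def volIn {V : Type*} [Fintype V] (G : SimpleGraph V) (U S : Finset V) : ℕ :=
  ∑ v ∈ S, degIn G U v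

/-- The set of edges of the induced subgraph `G[U]` with one endpoint in `S` and the other
in `U \ S`. -/
noncomputable def crossIn {V : Type*} [Fintype V] (G : SimpleGraph V) (U S : Finset V) :
    Finset (Sym2 V) :=
  Finset.univ.filter (fun e => e ∈ G.edgeSet ∧ ∃ v w, e = s(v, w) ∧ v ∈ S ∧ w ∈ U \ S)

/-- `T` is a trim-stable subset of `U`: `T ⊆ U` and every `v ∈ T` has at least
`(2/5)·d_G(v)` of its `G`-neighbors inside `T`. -/
noncomputable def TrimStable {V : Type*} [Fintype V] (G : SimpleGraph V) (U T : Finset V) :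
    Prop :=
  T ⊆ U ∧ ∀ v ∈ T, (2 : ℚ) / 5 * G.degree v ≤ ((G.neighborFinset v ∩ T).card : ℚ)

/-- The edge boundary of `S` is counted by summing, over `S`, the neighbors outside `S`. -/
theorem card_edgeBoundary {V : Type*} [Fintype V] (G : SimpleGraph V) (S : Finset V) :
    (edgeBoundary G S).card = ∑ v ∈ S, (G.neighborFinset v \ S).card := by
  rw [← Finset.card_sigma]
  symm
  refine Finset.card_bij (fun p _ => s(p.1, p.2)) ?_ ?_ ?_
  · rintro ⟨v, w⟩ h
    simp only [Finset.mem_sigma, Finset.mem_sdiff, SimpleGraph.mem_neighborFinset] at h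
    simp only [edgeBoundary, Finset.mem_filter, Finset.mem_univ, true_and, SimpleGraph.mem_edgeSet]
    exact ⟨h.2.1, v, w, rfl, h.1, h.2.2⟩
  · rintro ⟨v, w⟩ h ⟨v', w'⟩ h' heq
    simp only [Finset.mem_sigma, Finset.mem_sdiff] at h h'
    simp only [Sym2.eq_iff] at heq
    rcases heq with ⟨rfl, rfl⟩ | ⟨rfl, rfl⟩
    · rfl
    · exact absurd h.1 h'.2.2
  · intro e he
    simp only [edgeBoundary, Finset.mem_filter, Finset.mem_univ, true_and] at he
    obtain ⟨hG, v, w, rfl, hv, hw⟩ := he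
    refine ⟨⟨v, w⟩, ?_, rfl⟩
    simp only [Finset.mem_sigma, Finset.mem_sdiff, SimpleGraph.mem_neighborFinset]
    exact ⟨hv, hG, hw⟩

theorem edgeBoundary_compl {V : Type*} [Fintype V] (G : SimpleGraph V) (S : Finset V) :
    edgeBoundary G (Finset.univ \ S) = edgeBoundary G S := by
  ext e
  simp only [edgeBoundary, Finset.mem_filter, Finset.mem_univ, true_and, Finset.mem_sdiff, not_not]
  constructor <;> rintro ⟨hG, v, w, rfl, hv, hw⟩ <;> exact ⟨hG, w, v, Sym2.eq_swap, hw, hv⟩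

theorem crossIn_subset_edgeBoundary {V : Type*} [Fintype V] (G : SimpleGraph V)
    (U C : Finset V) : crossIn G U (C ∩ U) ⊆ edgeBoundary G C := by
  intro e
  simp only [edgeBoundary, crossIn, Finset.mem_filter, Finset.mem_univ, true_and,
    Finset.mem_sdiff, Finset.mem_inter]
  rintro ⟨hG, v, w, rfl, hv, hw⟩
  exact ⟨hG, v, w, rfl, hv.1, fun h => hw.2 ⟨h, hw.1⟩⟩

/-- Removing `v` from `S` makes the edges from `v` to `S` cross and those leaving `S` not. -/
theorem card_edgeBoundary_erase {V : Type*} [Fintype V] (G : SimpleGraph V) {S : Finset V}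
    {v : V} (hv : v ∈ S) :
    (edgeBoundary G (S.erase v)).card + (G.neighborFinset v \ S).card =
      (edgeBoundary G S).card + (G.neighborFinset v ∩ S).card := by
  have key : ∀ u ∈ S.erase v, (G.neighborFinset u \ S.erase v).card =
      (G.neighborFinset u \ S).card + if G.Adj v u then 1 else 0 := by
    intro u _
    split_ifs with h
    · have : G.neighborFinset u \ S.erase v = insert v (G.neighborFinset u \ S) := by
        ext x
        have := h.symm
        simp only [Finset.mem_sdiff, SimpleGraph.mem_neighborFinset, Finset.mem_erase,
          Finset.mem_insert]
        grind
      rw [this, Finset.card_insert_of_notMem (by simp [hv])]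
    · congr 1
      ext x
      have : ¬ G.Adj u v := fun h' => h h'.symm
      simp only [Finset.mem_sdiff, SimpleGraph.mem_neighborFinset, Finset.mem_erase]
      grind
  have hN : (S.erase v).filter (G.Adj v) = G.neighborFinset v ∩ S := by
    ext x
    have := G.loopless.irrefl v
    simp only [Finset.mem_filter, SimpleGraph.mem_neighborFinset, Finset.mem_erase,
      Finset.mem_inter]
    grind
  rw [card_edgeBoundary, card_edgeBoundary, Finset.sum_congr rfl key, Finset.sum_add_distrib,
    ← Finset.card_filter, hN, ← Finset.add_sum_erase S _ hv]
  omega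

theorem minDeg_le_degree {V : Type*} [Fintype V] (G : SimpleGraph V) (v : V) :
    minDeg G ≤ G.degree v := Nat.sInf_le ⟨v, rfl⟩

theorem edgeConn_le_minDeg {V : Type*} [Fintype V] [Nontrivial V] (G : SimpleGraph V) :
    edgeConn G ≤ minDeg G := by
  obtain ⟨v, hv⟩ : minDeg G ∈ {n | ∃ v : V, G.degree v = n} :=
    Nat.sInf_mem ⟨_, Classical.arbitrary V, rfl⟩
  rw [← hv]
  refine (edgeConn_le_card_edgeBoundary G (Finset.singleton_nonempty v) ?_).trans ?_
  · intro h
    obtain ⟨w, hw⟩ := exists_ne v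
    exact hw (Finset.mem_singleton.1 (h ▸ Finset.mem_univ w))
  · rw [card_edgeBoundary, Finset.sum_singleton, ← SimpleGraph.card_neighborFinset_eq_degree]
    exact Finset.card_le_card Finset.sdiff_subset

/-- A vertex of a minimum cut with another vertex sends at most half of its edges across. -/
theorem card_sdiff_le_card_inter_of_isNonsingletonMinCut {V : Type*} [Fintype V]
    (G : SimpleGraph V) {C : Finset V} (hC : IsNonsingletonMinCut G C) {v : V} (hv : v ∈ C) :
    (G.neighborFinset v \ C).card ≤ (G.neighborFinset v ∩ C).card := by
  have h := card_edgeBoundary_erase G hv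
  have hne : (C.erase v).Nonempty := by
    rw [← Finset.card_pos, Finset.card_erase_of_mem hv]
    have := hC.1
    omega
  have hne' : C.erase v ≠ Finset.univ := fun h' =>
    Finset.notMem_erase v C (h' ▸ Finset.mem_univ v)
  have := edgeConn_le_card_edgeBoundary G hne hne'
  have := hC.2.2
  omega

theorem IsNonsingletonMinCut.compl {V : Type*} [Fintype V] {G : SimpleGraph V} {C : Finset V}
    (hC : IsNonsingletonMinCut G C) : IsNonsingletonMinCut G (Finset.univ \ C) := by
  refine ⟨hC.2.1, ?_, ?_⟩
  · simpa using hC.1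
  · rw [edgeBoundary_compl]
    exact hC.2.2

/-- The neighbors of `v` in `T` lie outside `C` or among the other vertices of `C ∩ T`. -/
theorem card_neighborFinset_inter_le {V : Type*} [Fintype V] (G : SimpleGraph V)
    (T C : Finset V) (v : V) : (G.neighborFinset v ∩ T).card ≤
      (G.neighborFinset v \ C).card + ((C ∩ T).erase v).card := by
  refine (Finset.card_le_card fun x hx => ?_).trans (Finset.card_union_le _ _)
  have := G.loopless.irrefl v
  simp only [Finset.mem_union, Finset.mem_inter, Finset.mem_sdiff, Finset.mem_erase,
    SimpleGraph.mem_neighborFinset] at hx ⊢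
  grind

/-- A cut of at most `δ` edges whose part in `U` has volume at most `δ ^ 2 / 40` contains at
most two vertices of a trim-stable subset of `U`. -/
theorem TrimStable.card_inter_le_two {V : Type*} [Fintype V] {G : SimpleGraph V}
    (hδ : 1 ≤ minDeg G) {U T C : Finset V} (hT : TrimStable G U T)
    (hvol : 40 * volIn G U (C ∩ U) ≤ minDeg G ^ 2)
    (hcut : (edgeBoundary G C).card ≤ minDeg G) : (C ∩ T).card ≤ 2 := by
  obtain ⟨hTU, htrim⟩ := hT
  have hdeg : ∀ u ∈ C ∩ T, 2 * minDeg G ≤ 5 * (G.neighborFinset u ∩ T).card := by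
    intro u hu
    have h := htrim u (Finset.mem_inter.1 hu).2
    have h' : (2 * G.degree u : ℚ) ≤ 5 * (G.neighborFinset u ∩ T).card := by linarith
    have h'' : 2 * G.degree u ≤ 5 * (G.neighborFinset u ∩ T).card := by exact_mod_cast h'
    have := minDeg_le_degree G u
    omega
  have hsmall : (C ∩ T).card * (2 * minDeg G) ≤ 5 * volIn G U (C ∩ U) := by
    rw [volIn, Finset.mul_sum, ← smul_eq_mul]
    refine (Finset.card_nsmul_le_sum (C ∩ T) (fun v => 5 * degIn G U v) _ fun u hu => ?_).trans
      (Finset.sum_le_sum_of_subset (Finset.inter_subset_inter_left hTU))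
    refine (hdeg u hu).trans (Nat.mul_le_mul_left 5 ?_)
    exact Finset.card_le_card (Finset.inter_subset_inter_left hTU)
  have hout : ∀ u ∈ C ∩ T,
      2 * minDeg G + 5 ≤ 5 * ((G.neighborFinset u \ C).card + (C ∩ T).card) := by
    intro u hu
    have h1 : (G.neighborFinset u ∩ T).card ≤
        (G.neighborFinset u \ C).card + ((C ∩ T).erase u).card :=
      card_neighborFinset_inter_le G T C u
    have h2 := Finset.card_erase_add_one hu
    have := hdeg u hu
    omega
  have hsum : (C ∩ T).card * (2 * minDeg G + 5) ≤
      5 * ((edgeBoundary G C).card + (C ∩ T).card * (C ∩ T).card) := by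
    have h := Finset.card_nsmul_le_sum (C ∩ T) _ _ hout
    rw [← Finset.mul_sum, Finset.sum_add_distrib, Finset.sum_const, smul_eq_mul, smul_eq_mul] at h
    refine h.trans (Nat.mul_le_mul_left 5 (Nat.add_le_add_right ?_ _))
    rw [card_edgeBoundary]
    exact Finset.sum_le_sum_of_subset Finset.inter_subset_left
  by_contra! hs
  generalize (C ∩ T).card = s at *
  generalize minDeg G = d at *
  have h16 : 16 * s ≤ d := by
    have : (16 * s) * d ≤ d * d := by nlinarith
    exact Nat.le_of_mul_le_mul_right this hδ
  nlinarith

/-- In a minimum cut whose part in `U` has small volume, no vertex has more than half of its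
edges, plus one, inside a trim-stable subset of `U`. -/
theorem TrimStable.filter_inter_eq_empty {V : Type*} [Fintype V] {G : SimpleGraph V}
    (hδ : 1 ≤ minDeg G) {U T C : Finset V} (hT : TrimStable G U T)
    (hC : IsNonsingletonMinCut G C) (hcut : (edgeBoundary G C).card ≤ minDeg G)
    (hvol : 40 * volIn G U (C ∩ U) ≤ minDeg G ^ 2) :
    T.filter (fun v => (G.degree v : ℚ) / 2 + 1 < ((G.neighborFinset v ∩ T).card : ℚ)) ∩ C =
      ∅ := by
  rw [Finset.eq_empty_iff_forall_notMem]
  intro v hv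
  simp only [Finset.mem_inter, Finset.mem_filter] at hv
  obtain ⟨⟨hvT, hshave⟩, hvC⟩ := hv
  have hs := hT.card_inter_le_two hδ hvol hcut
  have hshave' : G.degree v + 2 < 2 * (G.neighborFinset v ∩ T).card := by
    have : (G.degree v + 2 : ℚ) < 2 * (G.neighborFinset v ∩ T).card := by linarith
    exact_mod_cast this
  have hin : (G.neighborFinset v ∩ T).card ≤
      (G.neighborFinset v \ C).card + ((C ∩ T).erase v).card :=
    card_neighborFinset_inter_le G T C v
  have herase := Finset.card_erase_add_one (Finset.mem_inter.2 ⟨hvC, hvT⟩)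
  have hsplit := Finset.card_sdiff_add_card_inter (G.neighborFinset v) C
  rw [SimpleGraph.card_neighborFinset_eq_degree] at hsplit
  have := card_sdiff_le_card_inter_of_isNonsingletonMinCut G hC hvC
  omega

theorem shave_trim_respects_nonsingleton_mincuts
    {V : Type*} [Fintype V] (G : SimpleGraph V) (hδ : 1 ≤ minDeg G)
    (U : Finset V)
    (hexp : ∀ S : Finset V, S ⊆ U → S.Nonempty → S ≠ U →
      (40 : ℚ) / (minDeg G : ℚ) *
          min ((volIn G U S : ℚ)) ((volIn G U (U \ S) : ℚ)) ≤
        ((crossIn G U S).card : ℚ))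
    (U' : Finset V) (hU' : TrimStable G U U' ∧ ∀ T : Finset V, TrimStable G U T → T ⊆ U')
    (U'' : Finset V)
    (hU'' : U'' = U'.filter (fun v =>
      (G.degree v : ℚ) / 2 + 1 < ((G.neighborFinset v ∩ U').card : ℚ))) :
    ∀ C : Finset V, IsNonsingletonMinCut G C → U'' ⊆ C ∨ U'' ∩ C = ∅ := by
  intro C hC
  have : Nontrivial V := by
    obtain ⟨a, -, b, -, hab⟩ := Finset.one_lt_card.1 hC.1
    exact ⟨a, b, hab⟩
  have hcut : (edgeBoundary G C).card ≤ minDeg G := hC.2.2.trans_le (edgeConn_le_minDeg G)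
  have hcompl : (Finset.univ \ C) ∩ U = U \ (C ∩ U) := by
    ext x
    simp only [Finset.mem_inter, Finset.mem_sdiff, Finset.mem_univ, true_and]
    tauto
  have hmin : 40 * volIn G U (C ∩ U) ≤ minDeg G ^ 2 ∨
      40 * volIn G U ((Finset.univ \ C) ∩ U) ≤ minDeg G ^ 2 := by
    rw [hcompl]
    by_cases hne : (C ∩ U).Nonempty
    · by_cases hU : C ∩ U = U
      · right
        simp [hU, volIn]
      · have h := hexp (C ∩ U) Finset.inter_subset_right hne hU
        have hcross : ((crossIn G U (C ∩ U)).card : ℚ) ≤ minDeg G := by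
          exact_mod_cast (Finset.card_le_card (crossIn_subset_edgeBoundary G U C)).trans hcut
        have hpos : (0 : ℚ) < minDeg G := by exact_mod_cast hδ
        have h' := h.trans hcross
        rw [div_mul_eq_mul_div, div_le_iff₀ hpos, ← sq] at h'
        rcases min_choice (volIn G U (C ∩ U) : ℚ) (volIn G U (U \ (C ∩ U)) : ℚ) with hm | hm
        · left
          rw [hm] at h'
          exact_mod_cast h'
        · right
          rw [hm] at h'
          exact_mod_cast h'
    · left
      simp [Finset.not_nonempty_iff_eq_empty.1 hne, volIn]
  subst hU''
  rcases hmin with h | h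
  · exact Or.inr (hU'.1.filter_inter_eq_empty hδ hC hcut h)
  · left
    have hempty := hU'.1.filter_inter_eq_empty hδ hC.compl
      ((edgeBoundary_compl G C).symm ▸ hcut) h
    intro x hx
    by_contra hxC
    exact Finset.eq_empty_iff_forall_notMem.1 hempty x
      (Finset.mem_inter.2 ⟨hx, Finset.mem_sdiff.2 ⟨Finset.mem_univ x, hxC⟩⟩)
end

section
/- There is an absolute constant c > 0 with the following property. For every finite simple graph G on a vertex set V with m ≥ 1 edges and every φ ∈ (0, 1), there exists a partition {U₁, …, U_k} of V into pairwise disjoint nonempty sets such that (a) Σ_{i=1}^{k} |∂_G(U_i)| ≤ c · φ · m · log₂(2m), and (b) for each i, the induced subgraph G[U_i] is a φ-expander: for every S with ∅ ⊊ S ⊊ U_i, the number of edges of G[U_i] between S and U_i ∖ S is at least φ·min(vol_{G[U_i]}(S), vol_{G[U_i]}(U_i ∖ S)). -/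
open scoped Classical

lemma logb_two_natCast_nonneg (n : ℕ) : 0 ≤ Real.logb 2 (n : ℝ) :=
  div_nonneg (Real.log_natCast_nonneg n) (Real.log_nonneg one_le_two)

lemma volIn_eq_card_interedges {V : Type*} [Fintype V] (G : SimpleGraph V) (U S : Finset V) :
    volIn G U S = (G.interedges S U).card := by
  have h : G.interedges S U = S.biUnion fun v => (G.neighborFinset v ∩ U).image (Prod.mk v) := by
    ext ⟨v, w⟩
    simp only [SimpleGraph.mk_mem_interedges_iff, Finset.mem_biUnion, Finset.mem_image,
      Finset.mem_inter, SimpleGraph.mem_neighborFinset, Prod.mk.injEq]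
    grind
  rw [h, Finset.card_biUnion]
  · exact Finset.sum_congr rfl fun v _ =>
      (Finset.card_image_of_injective _ (Prod.mk_right_injective v)).symm
  · intro v _ w _ hvw
    exact Finset.disjoint_left.2 (by grind)

lemma volIn_comm {V : Type*} [Fintype V] (G : SimpleGraph V) (U S : Finset V) :
    volIn G U S = volIn G S U := by
  rw [volIn_eq_card_interedges, volIn_eq_card_interedges]
  have : Std.Symm G.Adj := ⟨fun _ _ h => h.symm⟩
  exact Rel.card_interedges_comm S U

lemma volIn_union_right {V : Type*} [Fintype V] (G : SimpleGraph V) (U : Finset V)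
    {S T : Finset V} (h : Disjoint S T) : volIn G U (S ∪ T) = volIn G U S + volIn G U T :=
  Finset.sum_union h

lemma volIn_union_left {V : Type*} [Fintype V] (G : SimpleGraph V) (U : Finset V)
    {S T : Finset V} (h : Disjoint S T) : volIn G (S ∪ T) U = volIn G S U + volIn G T U := by
  simp only [volIn_comm G _ U, volIn_union_right G U h]

lemma volIn_mono {V : Type*} [Fintype V] (G : SimpleGraph V) {U U' : Finset V} (h : U ⊆ U')
    (S : Finset V) : volIn G U S ≤ volIn G U' S :=
  Finset.sum_le_sum fun _ _ => Finset.card_le_card (Finset.inter_subset_inter_left h)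

lemma sum_volIn_parts {V : Type*} [Fintype V] (G : SimpleGraph V) (U : Finset V)
    {S : Finset V} (P : Finpartition S) : ∑ p ∈ P.parts, volIn G U p = volIn G U S := by
  conv_rhs => rw [← P.biUnion_parts]
  exact (Finset.sum_biUnion P.disjoint).symm

lemma card_crossIn {V : Type*} [Fintype V] (G : SimpleGraph V) (U S : Finset V) :
    (crossIn G U S).card = volIn G (U \ S) S := by
  have h : crossIn G U S = (G.interedges S (U \ S)).image fun x => s(x.1, x.2) := by
    ext e
    simp only [crossIn, Finset.mem_filter, Finset.mem_univ, true_and, Finset.mem_image,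
      SimpleGraph.mem_interedges_iff, Prod.exists]
    constructor
    · rintro ⟨he, v, w, rfl, hv, hw⟩
      exact ⟨v, w, ⟨hv, hw, he⟩, rfl⟩
    · rintro ⟨v, w, ⟨hv, hw, he⟩, rfl⟩
      exact ⟨he, v, w, rfl, hv, hw⟩
  rw [h, volIn_eq_card_interedges, Finset.card_image_of_injOn]
  rintro ⟨a, b⟩ hab ⟨c, d⟩ hcd h
  simp only [Finset.mem_coe, SimpleGraph.mk_mem_interedges_iff, Finset.mem_sdiff] at hab hcd
  simp only [Sym2.eq_iff] at h
  grind

lemma edgeBoundary_eq_crossIn {V : Type*} [Fintype V] (G : SimpleGraph V) (S : Finset V) :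
    edgeBoundary G S = crossIn G Finset.univ S := by
  simp [edgeBoundary, crossIn]

lemma volIn_univ_univ {V : Type*} [Fintype V] (G : SimpleGraph V) :
    volIn G Finset.univ Finset.univ = 2 * G.edgeFinset.card := by
  simp [volIn, degIn, SimpleGraph.sum_degrees_eq_twice_card_edges]

/-- The real function `n * log₂ n` is monotone on the natural numbers. -/
lemma nat_mul_logb_mono {a b : ℕ} (h : a ≤ b) :
    (a : ℝ) * Real.logb 2 a ≤ b * Real.logb 2 b := by
  rcases Nat.eq_zero_or_pos a with rfl | ha
  · simpa using mul_nonneg b.cast_nonneg (logb_two_natCast_nonneg b)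
  · have ha' : (0 : ℝ) < a := by exact_mod_cast ha
    have hab : (a : ℝ) ≤ b := by exact_mod_cast h
    exact mul_le_mul hab (Real.logb_le_logb_of_le one_lt_two ha' hab)
      (logb_two_natCast_nonneg a) b.cast_nonneg

lemma nat_mul_logb_add_le_of_le {a b : ℕ} (h : a ≤ b) :
    (a : ℝ) * Real.logb 2 a + b * Real.logb 2 b + a ≤ (a + b : ℕ) * Real.logb 2 (a + b : ℕ) := by
  rcases Nat.eq_zero_or_pos a with rfl | ha
  · simp
  have ha' : (0 : ℝ) < a := by exact_mod_cast ha
  have hab : (a : ℝ) ≤ b := by exact_mod_cast h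
  have h₁ : 1 + Real.logb 2 a ≤ Real.logb 2 (a + b) := by
    have h₂ : 1 + Real.logb 2 a = Real.logb 2 (2 * a) := by
      rw [Real.logb_mul two_ne_zero ha'.ne', Real.logb_self_eq_one one_lt_two]
    rw [h₂]
    exact Real.logb_le_logb_of_le one_lt_two (by positivity) (by linarith)
  have h₃ : Real.logb 2 b ≤ Real.logb 2 (a + b) :=
    Real.logb_le_logb_of_le one_lt_two (by linarith) (by linarith)
  push_cast
  nlinarith [mul_le_mul_of_nonneg_left h₁ ha'.le,
    mul_le_mul_of_nonneg_left h₃ (ha'.le.trans hab)]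

/-- Superadditivity of `n * log₂ n`, with the smaller summand as surplus. -/
lemma nat_mul_logb_add_le (a b : ℕ) :
    (a : ℝ) * Real.logb 2 a + b * Real.logb 2 b + min (a : ℝ) b ≤
      (a + b : ℕ) * Real.logb 2 (a + b : ℕ) := by
  rcases le_total a b with h | h
  · rw [min_eq_left (by exact_mod_cast h)]
    exact nat_mul_logb_add_le_of_le h
  · rw [min_eq_right (by exact_mod_cast h), add_comm a b]
    linarith [nat_mul_logb_add_le_of_le h]

/-- The partition of `S ∪ T` obtained from partitions of two disjoint sets `S` and `T`. -/
noncomputable def Finpartition.disjointUnion {V : Type*} {S T : Finset V} (P : Finpartition S)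
    (Q : Finpartition T) (h : Disjoint S T) : Finpartition (S ∪ T) where
  parts := P.parts ∪ Q.parts
  supIndep := P.supIndep.union Q.supIndep (by rwa [P.sup_parts, Q.sup_parts])
  sup_parts := by rw [Finset.sup_union, P.sup_parts, Q.sup_parts]; rfl
  bot_notMem := by simp [P.empty_notMem_parts, Q.empty_notMem_parts]

lemma Finpartition.disjoint_parts {V : Type*} {S T : Finset V} (P : Finpartition S)
    (Q : Finpartition T) (h : Disjoint S T) : Disjoint P.parts Q.parts := by
  rw [Finset.disjoint_left]
  intro p hp hq
  exact P.ne_empty hp (Finset.disjoint_self_iff_empty _ |>.1 (h.mono (P.subset hp) (Q.subset hq)))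

lemma sum_volIn_sdiff_union {V : Type*} [Fintype V] (G : SimpleGraph V) {S T : Finset V}
    (P : Finpartition S) (h : Disjoint S T) :
    ∑ p ∈ P.parts, volIn G ((S ∪ T) \ p) p =
      ∑ p ∈ P.parts, volIn G (S \ p) p + volIn G T S := by
  rw [← sum_volIn_parts G T P, ← Finset.sum_add_distrib]
  refine Finset.sum_congr rfl fun p hp => ?_
  have hpT : Disjoint T p := (h.mono_left (P.subset hp)).symm
  rw [Finset.union_sdiff_distrib, Finset.sdiff_eq_self_of_disjoint hpT,
    volIn_union_left G p (h.mono_left Finset.sdiff_subset)]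

lemma exists_expander_finpartition {V : Type*} [Fintype V] (G : SimpleGraph V) {φ : ℝ}
    (hφ : 0 < φ) (U : Finset V) :
    ∃ P : Finpartition U,
      ((∑ p ∈ P.parts, volIn G (U \ p) p : ℕ) : ℝ) ≤
          2 * φ * ((volIn G U U : ℝ) * Real.logb 2 (volIn G U U)) ∧
        ∀ p ∈ P.parts, ∀ S : Finset V, S ⊆ p → S.Nonempty → S ≠ p →
          φ * min ((volIn G p S : ℝ)) ((volIn G p (p \ S) : ℝ)) ≤ ((crossIn G p S).card : ℝ) := by
  induction U using Finset.strongInduction with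
  | H U ih =>
    by_cases hU : ∀ S : Finset V, S ⊆ U → S.Nonempty → S ≠ U →
        φ * min ((volIn G U S : ℝ)) ((volIn G U (U \ S) : ℝ)) ≤ ((crossIn G U S).card : ℝ)
    · have htop : ∀ p ∈ (⊤ : Finpartition U).parts, p = U := fun p hp =>
        Finset.mem_singleton.1 (Finpartition.parts_top_subset U hp)
      refine ⟨⊤, ?_, fun p hp => htop p hp ▸ hU⟩
      have hcost : ∑ p ∈ (⊤ : Finpartition U).parts, volIn G (U \ p) p = 0 :=
        Finset.sum_eq_zero fun p hp => by simp [htop p hp, volIn, degIn]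
      rw [hcost]
      have := logb_two_natCast_nonneg (volIn G U U)
      simp only [Nat.cast_zero]
      positivity
    · push Not at hU
      obtain ⟨S, hSU, hS, hne, hcut⟩ := hU
      obtain ⟨T, hT⟩ : ∃ T, T = U \ S := ⟨_, rfl⟩
      have hdisj : Disjoint S T := hT ▸ Finset.disjoint_sdiff
      have hunion : S ∪ T = U := by rw [hT, Finset.union_sdiff_of_subset hSU]
      have hTU : T ⊂ U := hT ▸ Finset.sdiff_ssubset hSU hS
      obtain ⟨P, hP, hPexp⟩ := ih S (hSU.ssubset_of_ne hne)
      obtain ⟨Q, hQ, hQexp⟩ := ih T hTU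
      rw [card_crossIn, ← hT] at hcut
      subst hunion
      refine ⟨P.disjointUnion Q hdisj, ?_, fun p hp => ?_⟩
      · have hcost : ∑ p ∈ (P.disjointUnion Q hdisj).parts, volIn G ((S ∪ T) \ p) p =
            ∑ p ∈ P.parts, volIn G (S \ p) p + ∑ p ∈ Q.parts, volIn G (T \ p) p +
              2 * volIn G T S := by
          have hQ' := sum_volIn_sdiff_union G Q hdisj.symm
          rw [Finset.union_comm T S, volIn_comm G S T] at hQ'
          rw [Finpartition.disjointUnion, Finset.sum_union (P.disjoint_parts Q hdisj),
            sum_volIn_sdiff_union G P hdisj, hQ']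
          ring
        have hvol := volIn_union_right G (S ∪ T) hdisj
        have hlog := nat_mul_logb_add_le (volIn G (S ∪ T) S) (volIn G (S ∪ T) T)
        have hlogS := nat_mul_logb_mono (volIn_mono G (Finset.subset_union_left : S ⊆ S ∪ T) S)
        have hlogT := nat_mul_logb_mono (volIn_mono G (Finset.subset_union_right : T ⊆ S ∪ T) T)
        rw [hcost, hvol]
        push_cast at hP hQ hlog ⊢
        have key := mul_le_mul_of_nonneg_left
          ((add_le_add (add_le_add hlogS hlogT) le_rfl).trans hlog) hφ.le
        linarith
      · rcases Finset.mem_union.1 hp with hp | hp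
        · exact hPexp p hp
        · exact hQexp p hp

theorem expander_decomposition_exists :
    ∃ c : ℝ, 0 < c ∧
      ∀ (V : Type) [Fintype V] (G : SimpleGraph V), 1 ≤ G.edgeFinset.card →
        ∀ φ : ℝ, 0 < φ → φ < 1 →
          ∃ P : Finpartition (Finset.univ : Finset V),
            (∑ p ∈ P.parts, ((edgeBoundary G p).card : ℝ)) ≤
                c * φ * (G.edgeFinset.card : ℝ) *
                  Real.logb 2 (2 * (G.edgeFinset.card : ℝ)) ∧
              ∀ p ∈ P.parts, ∀ S : Finset V, S ⊆ p → S.Nonempty → S ≠ p →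
                φ * min ((volIn G p S : ℝ)) ((volIn G p (p \ S) : ℝ)) ≤
                  ((crossIn G p S).card : ℝ) := by
  refine ⟨4, by norm_num, fun V _ G _ φ hφ _ => ?_⟩
  obtain ⟨P, hP, hexp⟩ := exists_expander_finpartition G hφ Finset.univ
  refine ⟨P, ?_, hexp⟩
  rw [volIn_univ_univ] at hP
  push_cast at hP
  simp only [edgeBoundary_eq_crossIn, card_crossIn]
  linarith
end
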